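/- arXiv:1309.6267 — 2 statements merged into one kernel-verified Lean document; each statement's English description precedes it below -/
import Mathlib

section
/- Suppose h belongs to ℛ (i.e. Case 1 or Case 2 holds) and q satisfies the corresponding tail condition. For each t > 0 let 𝒳_t be a random variable with the tilted density π_t(x) = e^{tx} p(x)/Φ(t). Then as t → ∞ the normalized random variables (𝒳_t − m(t))/s(t) converge in distribution to the standard normal distribution N(0,1). -/
open Real Filter MeasureTheory Set ProbabilityTheory Asymptotics

noncomputable section

/-- `f` is regularly varying at infinity with index `α`: `f` is eventually positive and
`f (λ t) / f t → λ ^ α` as `t → ∞` for every `λ > 0`. -/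
def RegVary (α : ℝ) (f : ℝ → ℝ) : Prop :=
  (∀ᶠ x in atTop, 0 < f x) ∧
  ∀ lam : ℝ, 0 < lam →
    Tendsto (fun t => f (lam * t) / f t) atTop (nhds (lam ^ α))

/-- Case 1 (the regularly varying case) for the function `h = g'`:
`h x = c x^β exp (∫₁^x ε(u)/u du)` with `β > 0`, `c > 0`, `ε` twice differentiable with
`ε(x) → 0`, `x ε'(x) = O(1)`, `x² ε''(x) = O(1)`, and `|h''| ∈ RV(θ)` for some `θ ≤ β - 2`. -/
structure Case1 (h : ℝ → ℝ) (β c θ : ℝ) (ε : ℝ → ℝ) : Prop where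
  beta_pos : 0 < β
  c_pos : 0 < c
  h_eq : ∀ x ≥ (1:ℝ), h x = c * x ^ β * Real.exp (∫ u in (1:ℝ)..x, ε u / u)
  eps_diff : ∀ x ≥ (1:ℝ), DifferentiableAt ℝ ε x
  eps_diff2 : ∀ x ≥ (1:ℝ), DifferentiableAt ℝ (deriv ε) x
  eps_to_zero : Tendsto ε atTop (nhds 0)
  eps_deriv_bigO : (fun x => x * deriv ε x) =O[atTop] (fun _ => (1:ℝ))
  eps_deriv2_bigO : (fun x => x ^ 2 * deriv (deriv ε) x) =O[atTop] (fun _ => (1:ℝ))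
  h2_RV : RegVary θ (fun x => |deriv (deriv h) x|)
  theta_le : θ ≤ β - 2

/-- Case 2 (the rapidly varying case), stated through `ψ = h⁻¹`:
`ψ t = c exp (∫₁^t ε(u)/u du)` with `c > 0`, `ε` twice differentiable with `ε(t) → 0`,
`t ε'(t)/ε(t) → 0` and `t² ε''(t)/ε(t) → 0`. -/
structure Case2 (ψ : ℝ → ℝ) (c : ℝ) (ε : ℝ → ℝ) : Prop where
  c_pos : 0 < c
  psi_eq : ∀ t ≥ (1:ℝ), ψ t = c * Real.exp (∫ u in (1:ℝ)..t, ε u / u)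
  eps_diff : ∀ t ≥ (1:ℝ), DifferentiableAt ℝ ε t
  eps_diff2 : ∀ t ≥ (1:ℝ), DifferentiableAt ℝ (deriv ε) t
  eps_to_zero : Tendsto ε atTop (nhds 0)
  eps_ratio1 : Tendsto (fun t => t * deriv ε t / ε t) atTop (nhds 0)
  eps_ratio2 : Tendsto (fun t => t ^ 2 * deriv (deriv ε) t / ε t) atTop (nhds 0)

/-- Dominated convergence against densities with fourth-order polynomial decay, for test functions
of at most quadratic growth. -/
lemma tendsto_integral_mul_of_le_inv_sq {w F : ℝ → ℝ → ℝ} {w₀ F₀ : ℝ → ℝ} {C A : ℝ}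
    (hw_meas : ∀ᶠ t in atTop, AEStronglyMeasurable (w t))
    (hw_bound : ∀ᶠ t in atTop, ∀ᵐ y, |w t y| ≤ C * ((1 + y ^ 2) ^ 2)⁻¹)
    (hw_lim : ∀ y, Tendsto (fun t => w t y) atTop (nhds (w₀ y)))
    (hF_meas : ∀ t, AEStronglyMeasurable (F t))
    (hF_bound : ∀ᶠ t in atTop, ∀ y, |F t y| ≤ A * (1 + y ^ 2))
    (hF_lim : ∀ y, Tendsto (fun t => F t y) atTop (nhds (F₀ y))) :
    Tendsto (fun t => ∫ y, F t y * w t y) atTop (nhds (∫ y, F₀ y * w₀ y)) := by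
  refine tendsto_integral_filter_of_dominated_convergence (fun y => A * C * (1 + y ^ 2)⁻¹)
    ?_ ?_ (integrable_inv_one_add_sq.const_mul _) ?_
  · filter_upwards [hw_meas] with t ht using (hF_meas t).mul ht
  · filter_upwards [hw_bound, hF_bound] with t hw hF
    filter_upwards [hw] with y hy
    have h1 : (0 : ℝ) < 1 + y ^ 2 := by positivity
    calc ‖F t y * w t y‖ = |F t y| * |w t y| := by rw [norm_mul]; rfl
      _ ≤ (A * (1 + y ^ 2)) * (C * ((1 + y ^ 2) ^ 2)⁻¹) :=
        mul_le_mul (hF y) hy (abs_nonneg _) ((abs_nonneg _).trans (hF y))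
      _ = A * C * (1 + y ^ 2)⁻¹ := by field_simp
  · exact ae_of_all _ fun y => (hF_lim y).mul (hw_lim y)

lemma integral_mul_exp_neg_sq_div_two (F : ℝ → ℝ) :
    ∫ y, F y * exp (-y ^ 2 / 2) = √(2 * π) * ∫ y, F y ∂(gaussianReal 0 1) := by
  rw [integral_gaussianReal_eq_integral_smul one_ne_zero, ← integral_const_mul]
  congr 1 with y
  have : √(2 * π) ≠ 0 := by positivity
  simp only [gaussianPDFReal, smul_eq_mul, sub_zero, NNReal.coe_one, mul_one]
  field_simp

/-- If the unnormalized densities `w t` converge to `exp (-y² / 2)` under a domination that is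
integrable against quadratic functions, then the laws they define, standardized by their own
mean and standard deviation, converge weakly to the standard normal law. -/
lemma tendsto_integral_standardized_gaussian {w : ℝ → ℝ → ℝ} {a b : ℝ → ℝ} {C : ℝ}
    (hw_meas : ∀ᶠ t in atTop, AEStronglyMeasurable (w t))
    (hw_bound : ∀ᶠ t in atTop, ∀ᵐ y, |w t y| ≤ C * ((1 + y ^ 2) ^ 2)⁻¹)
    (hw_lim : ∀ y, Tendsto (fun t => w t y) atTop (nhds (exp (-y ^ 2 / 2))))
    (ha : ∀ᶠ t in atTop, a t = (∫ y, y * w t y) / ∫ y, w t y)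
    (hb : ∀ᶠ t in atTop, b t = √((∫ y, (y - a t) ^ 2 * w t y) / ∫ y, w t y))
    (f : BoundedContinuousFunction ℝ ℝ) :
    Tendsto (fun t => (∫ y, f ((y - a t) / b t) * w t y) / ∫ y, w t y) atTop
      (nhds (∫ x, f x ∂(gaussianReal 0 1))) := by
  have hpi : √(2 * π) ≠ 0 := by positivity
  have key {F : ℝ → ℝ → ℝ} {F₀ : ℝ → ℝ} {A : ℝ} (h1 : ∀ t, AEStronglyMeasurable (F t))
      (h2 : ∀ᶠ t in atTop, ∀ y, |F t y| ≤ A * (1 + y ^ 2))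
      (h3 : ∀ y, Tendsto (fun t => F t y) atTop (nhds (F₀ y))) :
      Tendsto (fun t => ∫ y, F t y * w t y) atTop
        (nhds (√(2 * π) * ∫ y, F₀ y ∂(gaussianReal 0 1))) := by
    rw [← integral_mul_exp_neg_sq_div_two]
    exact tendsto_integral_mul_of_le_inv_sq hw_meas hw_bound hw_lim h1 h2 h3
  have h0 : Tendsto (fun t => ∫ y, w t y) atTop (nhds √(2 * π)) := by
    have := key (F := fun _ _ => 1) (F₀ := fun _ => 1) (A := 1) (fun t => by fun_prop)
      (.of_forall fun t y => by simp; positivity) (fun y => tendsto_const_nhds)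
    simpa using this
  have key' {F : ℝ → ℝ → ℝ} {F₀ : ℝ → ℝ} {A : ℝ} (h1 : ∀ t, AEStronglyMeasurable (F t))
      (h2 : ∀ᶠ t in atTop, ∀ y, |F t y| ≤ A * (1 + y ^ 2))
      (h3 : ∀ y, Tendsto (fun t => F t y) atTop (nhds (F₀ y))) :
      Tendsto (fun t => (∫ y, F t y * w t y) / ∫ y, w t y) atTop
        (nhds (∫ y, F₀ y ∂(gaussianReal 0 1))) := by
    have := (key h1 h2 h3).div h0 hpi
    rwa [mul_div_cancel_left₀ _ hpi] at this
  have ha0 : Tendsto a atTop (nhds 0) := by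
    have := key' (F := fun _ y => y) (F₀ := fun y => y) (A := 1) (fun t => by fun_prop)
      (.of_forall fun t y => by
        rw [abs_le]
        constructor <;> nlinarith [sq_nonneg (y - 1), sq_nonneg (y + 1)])
      (fun y => tendsto_const_nhds)
    rw [integral_id_gaussianReal] at this
    exact this.congr' (ha.mono fun t ht => ht.symm)
  have hb1 : Tendsto b atTop (nhds 1) := by
    have h1 : ∀ᶠ t in atTop, |a t| < 1 := by
      have := ha0.abs
      rw [abs_zero] at this
      exact this.eventually_lt_const one_pos
    have := key' (F := fun t y => (y - a t) ^ 2) (F₀ := fun y => (y - 0) ^ 2) (A := 2)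
      (fun t => by fun_prop)
      (h1.mono fun t ht y => by
        rw [abs_of_nonneg (sq_nonneg _)]
        have := abs_lt.1 ht
        nlinarith [sq_nonneg (y + a t)])
      (fun y => (ha0.const_sub y).pow 2)
    have hvar : ∫ y, (y - 0) ^ 2 ∂(gaussianReal 0 1) = 1 := by
      have h := variance_id_gaussianReal (μ := 0) (v := 1)
      rw [variance_eq_integral measurable_id.aemeasurable] at h
      simpa using h
    rw [hvar] at this
    have := (Real.continuous_sqrt.tendsto _).comp this
    rw [Real.sqrt_one] at this
    exact this.congr' (hb.mono fun t ht => ht.symm)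
  refine key' (A := ‖f‖) (fun t => ?_) (.of_forall fun t y => ?_) (fun y => ?_)
  · exact (f.continuous.comp (by fun_prop)).aestronglyMeasurable
  · calc |f ((y - a t) / b t)| ≤ ‖f‖ := f.norm_coe_le_norm _
      _ ≤ ‖f‖ * (1 + y ^ 2) := le_mul_of_one_le_right (norm_nonneg _) (by nlinarith [sq_nonneg y])
  · have := (ha0.const_sub y).div hb1 one_ne_zero
    rw [sub_zero, div_one] at this
    exact (f.continuous.tendsto y).comp this

lemma exists_mem_uIcc_sub_eq_mul {f f' : ℝ → ℝ} {a b : ℝ}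
    (hf : ∀ x ∈ uIcc a b, HasDerivAt f (f' x) x) :
    ∃ ξ ∈ uIcc a b, f b - f a = f' ξ * (b - a) := by
  rcases lt_trichotomy a b with h | h | h
  · rw [uIcc_of_le h.le] at hf ⊢
    obtain ⟨ξ, hξ, he⟩ := exists_hasDerivAt_eq_slope f f' h
      (fun x hx => (hf x hx).continuousAt.continuousWithinAt)
      (fun x hx => hf x (Ioo_subset_Icc_self hx))
    exact ⟨ξ, Ioo_subset_Icc_self hξ, by rw [he, div_mul_cancel₀ _ (sub_ne_zero.2 h.ne')]⟩
  · subst h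
    exact ⟨a, left_mem_uIcc, by simp⟩
  · rw [uIcc_of_ge h.le] at hf ⊢
    obtain ⟨ξ, hξ, he⟩ := exists_hasDerivAt_eq_slope f f' h
      (fun x hx => (hf x hx).continuousAt.continuousWithinAt)
      (fun x hx => hf x (Ioo_subset_Icc_self hx))
    refine ⟨ξ, Ioo_subset_Icc_self hξ, ?_⟩
    have := sub_ne_zero.2 h.ne'
    rw [he]
    field_simp
    ring

lemma tendsto_add_mul_div_self {x s : ℝ → ℝ} (hx : Tendsto x atTop atTop)
    (hsx : Tendsto (fun t => s t / x t) atTop (nhds 0)) (y : ℝ) :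
    Tendsto (fun t => (x t + s t * y) / x t) atTop (nhds 1) := by
  have h : Tendsto (fun t => 1 + s t / x t * y) atTop (nhds (1 + 0 * y)) :=
    tendsto_const_nhds.add (hsx.mul tendsto_const_nhds)
  rw [zero_mul, add_zero] at h
  refine h.congr' ?_
  filter_upwards [hx.eventually_ne_atTop 0] with t ht
  field_simp

lemma tendsto_add_mul_atTop {x s : ℝ → ℝ} (hx : Tendsto x atTop atTop)
    (hsx : Tendsto (fun t => s t / x t) atTop (nhds 0)) (y : ℝ) :
    Tendsto (fun t => x t + s t * y) atTop atTop := by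
  refine ((tendsto_add_mul_div_self hx hsx y).pos_mul_atTop one_pos hx).congr' ?_
  filter_upwards [hx.eventually_ne_atTop 0] with t ht
  field_simp

/-- The excess of `g` over its tangent of slope `t` at the point `x`, in the scale `s`. -/
def tangentExcess (g : ℝ → ℝ) (x s t y : ℝ) : ℝ := g (x + s * y) - g x - t * s * y

lemma tendsto_tangentExcess {g x s : ℝ → ℝ}
    (hg : ∀ u > 0, DifferentiableAt ℝ g u) (hmono : MonotoneOn (deriv g) (Ioi 0))
    (hs : ∀ᶠ t in atTop, 0 < s t) (hx : Tendsto x atTop atTop)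
    (hsx : Tendsto (fun t => s t / x t) atTop (nhds 0))
    (hstat : ∀ᶠ t in atTop, deriv g (x t) = t)
    (hD : ∀ z, Tendsto (fun t => s t * (deriv g (x t + s t * z) - t)) atTop (nhds z)) (y : ℝ) :
    Tendsto (fun t => tangentExcess g (x t) (s t) t y) atTop (nhds (y ^ 2 / 2)) := by
  have hlow : ∀ᶠ t in atTop, ∀ z ∈ uIcc 0 y, 0 < x t + s t * z := by
    filter_upwards [hx.eventually_gt_atTop 0,
      (tendsto_add_mul_atTop hx hsx y).eventually_gt_atTop 0, hs] with t h1 h2 h3 z hz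
    rcases le_total 0 y with hy | hy
    · rw [uIcc_of_le hy] at hz
      have := mul_nonneg h3.le hz.1
      linarith
    · rw [uIcc_of_ge hy] at hz
      have := mul_le_mul_of_nonneg_left hz.1 h3.le
      linarith
  have hDmono : ∀ᶠ t in atTop,
      MonotoneOn (fun z => s t * (deriv g (x t + s t * z) - t)) (uIcc 0 y) := by
    filter_upwards [hlow, hs] with t h1 h2 a ha b hb hab
    have := hmono (h1 a ha) (h1 b hb)
      (add_le_add_right (mul_le_mul_of_nonneg_left hab h2.le) _)
    exact mul_le_mul_of_nonneg_left (by linarith) h2.le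
  have hInt : ∀ᶠ t in atTop, ∫ z in (0 : ℝ)..y, s t * (deriv g (x t + s t * z) - t)
      = tangentExcess g (x t) (s t) t y := by
    filter_upwards [hlow, hDmono] with t h1 h2
    rw [intervalIntegral.integral_eq_sub_of_hasDerivAt
      (f := tangentExcess g (x t) (s t) t) ?_ h2.intervalIntegrable]
    · simp [tangentExcess]
    · intro z hz
      have e1 : HasDerivAt (fun z => x t + s t * z) (s t) z := by
        simpa using ((hasDerivAt_id z).const_mul (s t)).const_add (x t)
      have e2 := ((hg _ (h1 z hz)).hasDerivAt.comp z e1).sub_const (g (x t))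
      have e3 := e2.sub ((hasDerivAt_id z).const_mul (t * s t))
      refine e3.congr_deriv ?_
      ring
  have hlim : ∫ z in (0 : ℝ)..y, z = y ^ 2 / 2 := by rw [integral_id]; ring
  rw [← hlim]
  refine Tendsto.congr' hInt ?_
  refine intervalIntegral.tendsto_integral_filter_of_dominated_convergence
    (fun _ => |y| + 1) ?_ ?_ intervalIntegrable_const (ae_of_all _ fun z _ => hD z)
  · filter_upwards [hDmono] with t h2
    exact h2.intervalIntegrable.aestronglyMeasurable_restrict_uIoc
  · have h1 : ∀ᶠ t in atTop, |s t * (deriv g (x t + s t * y) - t)| < |y| + 1 :=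
      (hD y).abs.eventually_lt_const (lt_add_one _)
    filter_upwards [h1, hDmono, hstat] with t h1 h2 h3
    refine ae_of_all _ fun z hz => ?_
    have hz' := uIoc_subset_uIcc hz
    refine le_trans ?_ h1.le
    rw [Real.norm_eq_abs]
    have h0 : s t * (deriv g (x t + s t * 0) - t) = 0 := by simp [h3]
    rcases le_total 0 y with hy | hy
    · rw [uIcc_of_le hy] at hz'
      have a1 := h2 left_mem_uIcc (uIoc_subset_uIcc hz) hz'.1
      have a2 := h2 (uIoc_subset_uIcc hz) right_mem_uIcc hz'.2
      simp only [h0] at a1 a2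
      exact abs_le_abs_of_nonneg a1 a2
    · rw [uIcc_of_ge hy] at hz'
      have a1 := h2 (uIoc_subset_uIcc hz) left_mem_uIcc hz'.2
      have a2 := h2 right_mem_uIcc (uIoc_subset_uIcc hz) hz'.1
      simp only [h0] at a1 a2
      exact abs_le_abs_of_nonpos a1 a2

lemma tangentExcess_nonneg {g : ℝ → ℝ} {x s t y : ℝ}
    (hg : ∀ u > 0, DifferentiableAt ℝ g u) (hmono : MonotoneOn (deriv g) (Ioi 0))
    (hx : 0 < x) (hstat : deriv g x = t) (hy : 0 < x + s * y) :
    0 ≤ tangentExcess g x s t y := by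
  have hpos : ∀ u ∈ uIcc x (x + s * y), 0 < u := fun u hu => (lt_min hx hy).trans_le hu.1
  obtain ⟨ξ, hξ, he⟩ := exists_mem_uIcc_sub_eq_mul (f := g) (f' := deriv g)
    (fun u hu => (hg u (hpos u hu)).hasDerivAt)
  have : tangentExcess g x s t y = (deriv g ξ - deriv g x) * (x + s * y - x) := by
    rw [tangentExcess, he, hstat]; ring
  rw [this]
  rcases le_total x (x + s * y) with h | h
  · rw [uIcc_of_le h] at hξ
    exact mul_nonneg (sub_nonneg.2 (hmono hx (lt_of_lt_of_le hx hξ.1) hξ.1)) (sub_nonneg.2 h)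
  · rw [uIcc_of_ge h] at hξ
    exact mul_nonneg_of_nonpos_of_nonpos
      (sub_nonpos.2 (hmono (lt_of_lt_of_le hy hξ.1) hx hξ.2)) (sub_nonpos.2 h)

lemma mul_tangentExcess_le {g : ℝ → ℝ} {x s t e y : ℝ} (hconv : ConvexOn ℝ (Ioi 0) g)
    (hx : 0 < x) (hy : 0 < x + s * (e * y)) (h1 : 1 ≤ y) :
    y * tangentExcess g x s t e ≤ tangentExcess g x s t (e * y) := by
  have hy0 : 0 < y := by linarith
  have h := hconv.2 (mem_Ioi.2 hx) (mem_Ioi.2 hy)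
    (show 0 ≤ 1 - 1 / y by rw [sub_nonneg, div_le_one hy0]; exact h1)
    (show 0 ≤ 1 / y by positivity) (by ring)
  have he : (1 - 1 / y) • x + (1 / y) • (x + s * (e * y)) = x + s * e := by
    simp only [smul_eq_mul]; field_simp; ring
  rw [he] at h
  simp only [smul_eq_mul] at h
  have h2 := mul_le_mul_of_nonneg_left h hy0.le
  have h3 : y * ((1 - 1 / y) * g x + 1 / y * g (x + s * (e * y)))
      = (y - 1) * g x + g (x + s * (e * y)) := by field_simp
  rw [h3] at h2
  simp only [tangentExcess]
  nlinarith

lemma eventually_le_tangentExcess {g x s : ℝ → ℝ} (hconv : ConvexOn ℝ (Ioi 0) g)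
    (hg : ∀ u > 0, DifferentiableAt ℝ g u) (hmono : MonotoneOn (deriv g) (Ioi 0))
    (hs : ∀ᶠ t in atTop, 0 < s t) (hx : Tendsto x atTop atTop)
    (hsx : Tendsto (fun t => s t / x t) atTop (nhds 0))
    (hstat : ∀ᶠ t in atTop, deriv g (x t) = t)
    (hD : ∀ z, Tendsto (fun t => s t * (deriv g (x t + s t * z) - t)) atTop (nhds z)) :
    ∀ᶠ t in atTop, ∀ y, 0 < x t + s t * y →
      |y| / 4 - 1 ≤ tangentExcess g (x t) (s t) t y := by
  have key := tendsto_tangentExcess hg hmono hs hx hsx hstat hD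
  filter_upwards [(key 1).eventually_const_lt (show (1 / 4 : ℝ) < 1 ^ 2 / 2 by norm_num),
    (key (-1)).eventually_const_lt (show (1 / 4 : ℝ) < (-1) ^ 2 / 2 by norm_num),
    hx.eventually_gt_atTop 0, hstat] with t h1 h2 h3 h4 y hy
  rcases le_total |y| 1 with h | h
  · have := tangentExcess_nonneg hg hmono h3 h4 hy
    linarith
  · rcases le_total 0 y with h0 | h0
    · rw [abs_of_nonneg h0] at h ⊢
      have := mul_tangentExcess_le (s := s t) (t := t) (e := 1) hconv h3 (by rwa [one_mul]) h
      rw [one_mul] at this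
      nlinarith
    · rw [abs_of_nonpos h0] at h ⊢
      have := mul_tangentExcess_le (s := s t) (t := t) (e := -1) (y := -y) hconv h3
        (by simpa using hy) h
      rw [neg_one_mul, neg_neg] at this
      nlinarith

lemma exp_neg_abs_div_four_le (y : ℝ) : exp (-(|y| / 4)) ≤ 12290 * ((1 + y ^ 2) ^ 2)⁻¹ := by
  have h1 := Real.pow_div_factorial_le_exp (|y| / 4) (by positivity) 4
  have h2 := Real.one_le_exp (show 0 ≤ |y| / 4 by positivity)
  have h3 : (|y| / 4) ^ 4 = y ^ 4 / 256 := by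
    rw [div_pow, Even.pow_abs (by decide)]; norm_num
  rw [h3] at h1
  norm_num [Nat.factorial] at h1
  rw [exp_neg, ← div_eq_mul_inv, le_div_iff₀ (by positivity), inv_mul_le_iff₀ (exp_pos _)]
  nlinarith [sq_nonneg (y ^ 2 - 1)]

lemma deriv_log_integral_exp_mul {p Φ : ℝ → ℝ} (hp : ∀ x, 0 ≤ p x)
    (hΦ : ∀ t, Φ t = ∫ x, exp (t * x) * p x)
    (hint : ∀ t > (0 : ℝ), Integrable (fun x => exp (t * x) * p x)) {t : ℝ} (ht : 0 < t) :
    Integrable (fun x => x * (exp (t * x) * p x)) ∧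
    deriv (fun u => log (Φ u)) t = (∫ x, x * (exp (t * x) * p x)) / Φ t ∧
    iteratedDeriv 2 (fun u => log (Φ u)) t =
      (∫ x, (x - deriv (fun u => log (Φ u)) t) ^ 2 * (exp (t * x) * p x)) / Φ t := by
  have hpm : AEMeasurable p := by
    have h1 := (hint 1 one_pos).aestronglyMeasurable.aemeasurable
    have h2 : AEMeasurable (fun x : ℝ => exp (-(1 * x)) * (exp (1 * x) * p x)) :=
      AEMeasurable.mul (by fun_prop) h1
    refine h2.congr (ae_of_all _ fun x => ?_)
    simp only [← mul_assoc, ← exp_add]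
    simp
  let μ : Measure ℝ := volume.withDensity fun x => ENNReal.ofReal (p x)
  have hfin : ∀ᵐ x, ENNReal.ofReal (p x) < ⊤ := ae_of_all _ fun x => ENNReal.ofReal_lt_top
  have hI (F : ℝ → ℝ) : ∫ x, F x ∂μ = ∫ x, F x * p x := by
    rw [integral_withDensity_eq_integral_toReal_smul₀ hpm.ennreal_ofReal hfin]
    congr 1 with x
    rw [ENNReal.toReal_ofReal (hp x), smul_eq_mul, mul_comm]
  have hmgf : mgf id μ = Φ := by
    ext u
    rw [mgf, hI, hΦ]
    rfl
  have hcgf : cgf id μ = fun u => log (Φ u) := by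
    ext u
    rw [cgf, hmgf]
  have hmem : t ∈ interior (integrableExpSet id μ) := by
    rw [mem_interior]
    refine ⟨Ioi 0, fun u hu => ?_, isOpen_Ioi, ht⟩
    change Integrable _ _
    rw [integrable_withDensity_iff_integrable_smul₀' hpm.ennreal_ofReal hfin]
    refine (hint u hu).congr (ae_of_all _ fun x => ?_)
    simp only [ENNReal.toReal_ofReal (hp x), smul_eq_mul, id]
    ring
  rw [← hcgf]
  refine ⟨?_, ?_, ?_⟩
  · have h := integrable_pow_mul_exp_of_mem_interior_integrableExpSet hmem 1
    rw [integrable_withDensity_iff_integrable_smul₀' hpm.ennreal_ofReal hfin] at h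
    refine h.congr (ae_of_all _ fun x => ?_)
    simp only [ENNReal.toReal_ofReal (hp x), smul_eq_mul, id]
    ring
  · rw [deriv_cgf hmem, hmgf, hI]
    simp only [id, mul_assoc]
  · rw [iteratedDeriv_two_cgf_eq_integral hmem, hmgf, hI]
    simp only [id, mul_assoc]

/-- The density `exp (t u - (g u - q u))` on `(0, ∞)` in the coordinate `u = x + s y`, divided by
its value `exp (t x - g x)` without the factor `exp q` at `u = x`. -/
def localDensity (g q : ℝ → ℝ) (x s t y : ℝ) : ℝ :=
  if 0 < x + s * y then exp (-tangentExcess g x s t y + q (x + s * y)) else 0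

lemma measurable_localDensity {g q : ℝ → ℝ} (hg : ContinuousOn g (Ioi 0)) (hq : Measurable q)
    (x s t : ℝ) : Measurable (localDensity g q x s t) := by
  have h1 : Measurable ((Ioi 0).piecewise g 0) :=
    hg.measurable_piecewise continuousOn_const measurableSet_Ioi
  have h2 : localDensity g q x s t = fun y => if 0 < x + s * y then
      exp (-((Ioi 0).piecewise g 0 (x + s * y) - g x - t * s * y) + q (x + s * y)) else 0 := by
    ext y
    unfold localDensity tangentExcess
    split_ifs with h
    · rw [piecewise_eq_of_mem _ _ _ (mem_Ioi.2 h)]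
    · rfl
  rw [h2]
  refine Measurable.ite (measurableSet_lt (by fun_prop) (by fun_prop)) ?_ measurable_const
  have h3 : Measurable fun y => (Ioi 0).piecewise g 0 (x + s * y) := h1.comp (by fun_prop)
  have h4 : Measurable fun y => q (x + s * y) := hq.comp (by fun_prop)
  fun_prop

lemma integral_mul_exp_mul_eq {g q p : ℝ → ℝ}
    (hp : ∀ x, p x = if 0 ≤ x then exp (-(g x - q x)) else 0) {x s t : ℝ} (hs : 0 < s)
    (F : ℝ → ℝ) :
    ∫ u, F ((u - x) / s) * (exp (t * u) * p u) =
      s * exp (t * x - g x) * ∫ y, F y * localDensity g q x s t y := by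
  have h1 := integral_add_left_eq_self (μ := (volume : Measure ℝ))
    (fun u => F ((u - x) / s) * (exp (t * u) * p u)) x
  have h2 := Measure.integral_comp_mul_left (F := ℝ)
    (fun v => F ((x + v - x) / s) * (exp (t * (x + v)) * p (x + v))) s
  rw [h1, abs_of_pos (inv_pos.2 hs), smul_eq_mul, eq_inv_mul_iff_mul_eq₀ hs.ne'] at h2
  rw [← h2, mul_assoc, ← integral_const_mul (exp (t * x - g x))]
  congr 1
  refine integral_congr_ae ?_
  have hne : ∀ᵐ y : ℝ, y ≠ -x / s := by
    exact Measure.ae_ne volume _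
  filter_upwards [hne] with y hy
  have hy' : x + s * y ≠ 0 := fun h => hy (by field_simp; linarith)
  have e1 : (x + s * y - x) / s = y := by field_simp; ring
  rw [e1, hp, localDensity]
  rcases lt_or_gt_of_ne hy' with h | h
  · rw [if_neg h.not_ge, if_neg h.not_gt]; ring
  · rw [if_pos h.le, if_pos h, ← exp_add, mul_left_comm, ← exp_add]
    congr 2
    rw [tangentExcess]
    ring

/-- A central limit theorem for exponential tilting: it is enough that the rescaled slope
`s t * (g' (x t + s t * z) - t)` around the stationary point `x t` converges to `z`. -/
lemma tilted_clt_of_tendsto_slope {g q p Φ x s : ℝ → ℝ}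
    (hconv : ConvexOn ℝ (Ioi 0) g) (hg : ∀ u > 0, DifferentiableAt ℝ g u)
    (hq_meas : Measurable q) (hq_bdd : ∃ M : ℝ, ∀ x ≥ (0 : ℝ), |q x| ≤ M)
    (hq_lim : Tendsto q atTop (nhds 0))
    (hp : ∀ x, p x = if 0 ≤ x then exp (-(g x - q x)) else 0)
    (hΦ : ∀ t, Φ t = ∫ x, exp (t * x) * p x)
    (hint : ∀ t > (0 : ℝ), Integrable (fun x => exp (t * x) * p x))
    (hs : ∀ᶠ t in atTop, 0 < s t) (hx : Tendsto x atTop atTop)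
    (hsx : Tendsto (fun t => s t / x t) atTop (nhds 0))
    (hstat : ∀ᶠ t in atTop, deriv g (x t) = t)
    (hD : ∀ z, Tendsto (fun t => s t * (deriv g (x t + s t * z) - t)) atTop (nhds z))
    (f : BoundedContinuousFunction ℝ ℝ) :
    Tendsto (fun t => ∫ x, f ((x - deriv (fun u => log (Φ u)) t) /
        √(iteratedDeriv 2 (fun u => log (Φ u)) t)) * (exp (t * x) * p x / Φ t))
      atTop (nhds (∫ x, f x ∂(gaussianReal 0 1))) := by
  have hmono : MonotoneOn (deriv g) (Ioi 0) := hconv.monotoneOn_deriv hg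
  have hp0 : ∀ x, 0 ≤ p x := fun x => by rw [hp]; split_ifs <;> positivity
  obtain ⟨M, hM⟩ := hq_bdd
  set w : ℝ → ℝ → ℝ := fun t => localDensity g q (x t) (s t) t with hw
  set m := deriv (fun u => log (Φ u)) with hm
  set v := iteratedDeriv 2 (fun u => log (Φ u)) with hv
  have hlow := eventually_le_tangentExcess hconv hg hmono hs hx hsx hstat hD
  have hw_bound : ∀ᶠ t in atTop, ∀ᵐ y, |w t y| ≤ exp (M + 1) * 12290 * ((1 + y ^ 2) ^ 2)⁻¹ := by
    filter_upwards [hlow] with t ht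
    refine ae_of_all _ fun y => ?_
    simp only [hw, localDensity]
    split_ifs with h
    · rw [abs_exp, mul_assoc]
      refine le_trans ?_ (mul_le_mul_of_nonneg_left (exp_neg_abs_div_four_le y) (exp_pos _).le)
      rw [← exp_add, exp_le_exp]
      have := ht y h
      have := (abs_le.1 (hM _ h.le)).2
      linarith
    · rw [abs_zero]; positivity
  have hw_lim (y : ℝ) : Tendsto (fun t => w t y) atTop (nhds (exp (-y ^ 2 / 2))) := by
    have h1 := tendsto_tangentExcess hg hmono hs hx hsx hstat hD y
    have h2 := tendsto_add_mul_atTop hx hsx y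
    have h3 := (Real.continuous_exp.tendsto _).comp (h1.neg.add (hq_lim.comp h2))
    rw [show -(y ^ 2 / 2) + 0 = -y ^ 2 / 2 by ring] at h3
    refine h3.congr' ?_
    filter_upwards [h2.eventually_gt_atTop 0] with t ht
    simp only [hw, localDensity, if_pos ht, Function.comp]
  have hZ : ∀ᶠ t in atTop, Φ t = s t * exp (t * x t - g (x t)) * ∫ y, w t y := by
    filter_upwards [hs] with t ht
    rw [hΦ]
    simpa using integral_mul_exp_mul_eq hp ht (x := x t) (t := t) (fun _ => 1)
  have hratio : ∀ᶠ t in atTop, ∀ F : ℝ → ℝ,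
      (∫ u, F ((u - x t) / s t) * (exp (t * u) * p u)) / Φ t
        = (∫ y, F y * w t y) / ∫ y, w t y := by
    filter_upwards [hs, hZ] with t ht hZt F
    rw [integral_mul_exp_mul_eq hp ht, hZt, mul_div_mul_left]
    positivity
  have hZ0 : ∀ᶠ t in atTop, ∫ y, w t y ≠ 0 := by
    have h := tendsto_integral_mul_of_le_inv_sq (F := fun _ _ => 1) (F₀ := fun _ => 1) (A := 1)
      (.of_forall fun t => (measurable_localDensity (fun u hu =>
        (hg u hu).continuousAt.continuousWithinAt) hq_meas _ _ _).aestronglyMeasurable)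
      hw_bound hw_lim (fun t => by fun_prop) (.of_forall fun t y => by simp; positivity)
      (fun y => tendsto_const_nhds)
    rw [integral_mul_exp_neg_sq_div_two] at h
    have hne : √(2 * π) * ∫ _, (1 : ℝ) ∂(gaussianReal 0 1) ≠ 0 := by
      simp; positivity
    simpa using h.eventually_ne hne
  have ha : ∀ᶠ t in atTop, (m t - x t) / s t = (∫ y, y * w t y) / ∫ y, w t y := by
    filter_upwards [hs, hratio, eventually_gt_atTop 0, hZ, hZ0] with t ht hr ht0 hZt hZt0
    have hΦ0 : Φ t ≠ 0 := by rw [hZt]; positivity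
    obtain ⟨e0, e1, -⟩ := deriv_log_integral_exp_mul hp0 hΦ hint ht0
    rw [← hm] at e1
    have e2 : ∫ u, (u - x t) / s t * (exp (t * u) * p u)
        = (m t - x t) / s t * Φ t := by
      have e3 : ∀ u, (u - x t) / s t * (exp (t * u) * p u)
          = (s t)⁻¹ * (u * (exp (t * u) * p u) - x t * (exp (t * u) * p u)) := fun u => by
        field_simp
      simp only [e3]
      rw [integral_const_mul, integral_sub e0 ((hint t ht0).const_mul _), integral_const_mul,
        ← hΦ, (eq_div_iff hΦ0).1 e1 |>.symm]
      field_simp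
    have := hr (fun y => y)
    rw [← this, e2, mul_div_cancel_right₀ _ hΦ0]
  have hb : ∀ᶠ t in atTop, √(v t) / s t
      = √((∫ y, (y - (m t - x t) / s t) ^ 2 * w t y) / ∫ y, w t y) := by
    filter_upwards [hs, hratio, eventually_gt_atTop 0] with t ht hr ht0
    have e1 := (deriv_log_integral_exp_mul hp0 hΦ hint ht0).2.2
    rw [← hm, ← hv] at e1
    rw [← hr (fun y => (y - (m t - x t) / s t) ^ 2), e1]
    have e2 : ∀ u, ((u - x t) / s t - (m t - x t) / s t) ^ 2 * (exp (t * u) * p u)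
        = (s t ^ 2)⁻¹ * ((u - m t) ^ 2 * (exp (t * u) * p u)) := fun u => by
      field_simp
      ring
    simp only [e2]
    rw [integral_const_mul, mul_div_assoc, Real.sqrt_mul (by positivity), Real.sqrt_inv,
      Real.sqrt_sq ht.le]
    ring
  refine (tendsto_integral_standardized_gaussian (.of_forall fun t =>
    (measurable_localDensity (fun u hu => (hg u hu).continuousAt.continuousWithinAt)
      hq_meas _ _ _).aestronglyMeasurable) hw_bound hw_lim ha hb f).congr' ?_
  filter_upwards [hs, hratio] with t ht hr
  rw [← hr (fun y => f ((y - (m t - x t) / s t) / (√(v t) / s t))), ← integral_div]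
  congr 1 with u
  have : ((u - x t) / s t - (m t - x t) / s t) / (√(v t) / s t) = (u - m t) / √(v t) := by
    rw [← sub_div, div_div_div_cancel_right₀ ht.ne']
    ring
  rw [this]
  ring

lemma RegVary.tendsto_zero {η M : ℝ} {f : ℝ → ℝ} (h : RegVary η f) (hη : η < 0)
    (hb : ∀ᶠ x in atTop, f x ≤ M) : Tendsto f atTop (nhds 0) := by
  obtain ⟨hpos, hlim⟩ := h
  have hM : 0 < M := by
    obtain ⟨x, h1, h2⟩ := (hpos.and hb).exists
    exact h1.trans_le h2
  rw [tendsto_order]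
  refine ⟨fun e he => hpos.mono fun x hx => he.trans hx, fun e he => ?_⟩
  have h1 := (tendsto_rpow_neg_atTop (neg_pos.2 hη)).eventually_lt_const (div_pos he hM)
  simp only [neg_neg] at h1
  obtain ⟨lam, h2, h3⟩ := (h1.and (eventually_gt_atTop 0)).exists
  have h4 : ∀ᶠ t in atTop, f (lam * t) < e := by
    filter_upwards [(hlim lam h3).eventually_lt_const h2, hpos, hb] with t a1 a2 a3
    rw [div_lt_iff₀ a2] at a1
    calc f (lam * t) < e / M * f t := a1
      _ ≤ e / M * M := by gcongr
      _ = e := div_mul_cancel₀ _ hM.ne'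
  have h5 : Tendsto (fun u : ℝ => u / lam) atTop atTop := tendsto_id.atTop_div_const h3
  refine (h5.eventually h4).mono fun u hu => ?_
  rwa [mul_div_cancel₀ _ h3.ne'] at hu

/-- A function with bounded elasticity has asymptotically equal values at asymptotically equal
arguments. -/
lemma tendsto_div_comp_of_bounded_elasticity {f a b : ℝ → ℝ} {C : ℝ}
    (hpos : ∀ᶠ u in atTop, 0 < f u) (hd : ∀ᶠ u in atTop, DifferentiableAt ℝ f u)
    (hC : ∀ᶠ u in atTop, |u * deriv f u / f u| ≤ C)
    (ha : Tendsto a atTop atTop) (hab : Tendsto (fun t => b t / a t) atTop (nhds 1)) :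
    Tendsto (fun t => f (b t) / f (a t)) atTop (nhds 1) := by
  obtain ⟨T, hT⟩ := eventually_atTop.1 (hpos.and (hd.and hC))
  have hlog : Tendsto (fun t => log (f (b t)) - log (f (a t))) atTop (nhds 0) := by
    have h1 : Tendsto (fun t => 2 * C * |b t / a t - 1|) atTop (nhds 0) := by
      have := ((hab.sub_const 1).abs).const_mul (2 * C)
      simpa using this
    refine squeeze_zero_norm' ?_ h1
    filter_upwards [ha.eventually_ge_atTop (2 * T), ha.eventually_gt_atTop 0,
      hab.eventually_const_lt (show (1 / 2 : ℝ) < 1 by norm_num)] with t a1 a2 a3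
    have a4 : a t / 2 ≤ b t := by
      rw [lt_div_iff₀ a2] at a3
      linarith
    have hTu : ∀ u ∈ Ici (a t / 2), T ≤ u := fun u hu => by
      have := mem_Ici.1 hu
      linarith
    have key := Convex.norm_image_sub_le_of_norm_hasDerivWithin_le (s := Ici (a t / 2))
      (f := fun u => log (f u)) (f' := fun u => deriv f u / f u) (C := 2 * C / a t)
      (x := a t) (y := b t)
      (fun u hu => by
        obtain ⟨b1, b2, -⟩ := hT u (hTu u hu)
        exact (b2.hasDerivAt.log b1.ne').hasDerivWithinAt)
      (fun u hu => by
        obtain ⟨b1, b2, b3⟩ := hT u (hTu u hu)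
        have hu' := mem_Ici.1 hu
        have hu0 : 0 < u := by linarith
        rw [mul_div_assoc, abs_mul, abs_of_pos hu0] at b3
        rw [Real.norm_eq_abs, le_div_iff₀ a2]
        nlinarith [abs_nonneg (deriv f u / f u)])
      (convex_Ici _) (mem_Ici.2 (by linarith)) (mem_Ici.2 a4)
    refine key.trans (le_of_eq ?_)
    have e : b t / a t - 1 = (b t - a t) / a t := by field_simp
    rw [e, abs_div, abs_of_pos a2, Real.norm_eq_abs]
    ring
  have h2 := (Real.continuous_exp.tendsto _).comp hlog
  rw [exp_zero] at h2
  have hb : Tendsto b atTop atTop := by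
    refine (hab.pos_mul_atTop one_pos ha).congr' ?_
    filter_upwards [ha.eventually_ne_atTop 0] with t ht
    field_simp
  refine h2.congr' ?_
  filter_upwards [ha.eventually hpos, hb.eventually hpos] with t a1 a2
  simp only [Function.comp]
  rw [exp_sub, exp_log a1, exp_log a2]

lemma tendsto_div_of_mem_uIcc {a b ξ : ℝ → ℝ} (ha : Tendsto a atTop atTop)
    (hab : Tendsto (fun t => b t / a t) atTop (nhds 1))
    (hξ : ∀ᶠ t in atTop, ξ t ∈ uIcc (a t) (b t)) :
    Tendsto (fun t => ξ t / a t) atTop (nhds 1) := by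
  have h1 := (tendsto_const_nhds (x := (1 : ℝ))).min hab
  have h2 := (tendsto_const_nhds (x := (1 : ℝ))).max hab
  rw [min_self] at h1
  rw [max_self] at h2
  refine tendsto_of_tendsto_of_tendsto_of_le_of_le' h1 h2 ?_ ?_
  · filter_upwards [hξ, ha.eventually_gt_atTop 0] with t h h0
    have := div_le_div_of_nonneg_right h.1 h0.le
    rwa [← min_div_div_right h0.le, div_self h0.ne'] at this
  · filter_upwards [hξ, ha.eventually_gt_atTop 0] with t h h0
    have := div_le_div_of_nonneg_right h.2 h0.le
    rwa [← max_div_div_right h0.le, div_self h0.ne'] at this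

lemma hasDerivAt_karamata {f ε : ℝ → ℝ} {c β : ℝ}
    (hf : ∀ x ≥ (1 : ℝ), f x = c * x ^ β * exp (∫ u in (1 : ℝ)..x, ε u / u))
    (hε : ∀ x ≥ (1 : ℝ), DifferentiableAt ℝ ε x) {x : ℝ} (hx : 1 < x) :
    HasDerivAt f (f x * (β + ε x) / x) x := by
  have hx0 : 0 < x := one_pos.trans hx
  have hcont : ∀ u ≥ (1 : ℝ), ContinuousAt (fun u => ε u / u) u := fun u hu =>
    (hε u hu).continuousAt.div continuousAt_id (by positivity)
  have hI : HasDerivAt (fun x => ∫ u in (1 : ℝ)..x, ε u / u) (ε x / x) x := by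
    refine intervalIntegral.integral_hasDerivAt_right ?_ ?_ (hcont x hx.le)
    · refine ContinuousOn.intervalIntegrable fun u hu => ?_
      rw [uIcc_of_le hx.le] at hu
      exact (hcont u hu.1).continuousWithinAt
    · exact ContinuousOn.stronglyMeasurableAtFilter isOpen_Ioi
        (fun u hu => (hcont u (le_of_lt hu)).continuousWithinAt) x (mem_Ioi.2 hx)
  have h := (((hasDerivAt_id x).rpow_const (p := β) (Or.inl hx0.ne')).const_mul c).mul hI.exp
  have h' := h.congr_of_eventuallyEq (f₁ := f) (by
    filter_upwards [Ioi_mem_nhds hx] with u hu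
    simpa using hf u (le_of_lt hu))
  refine h'.congr_deriv ?_
  rw [hf x hx.le, id, rpow_sub_one hx0.ne']
  field_simp

lemma Case1.tendsto_slope {h ψ ε : ℝ → ℝ} {β c θ : ℝ} (hc : Case1 h β c θ ε)
    (hψ_inv : ∀ᶠ t in atTop, h (ψ t) = t) (hψ_top : Tendsto ψ atTop atTop) :
    ∃ s : ℝ → ℝ, (∀ᶠ t in atTop, 0 < s t) ∧ Tendsto (fun t => s t / ψ t) atTop (nhds 0) ∧
      ∀ z, Tendsto (fun t => s t * (h (ψ t + s t * z) - t)) atTop (nhds z) := by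
  have hβ := hc.beta_pos
  have hder {x : ℝ} (hx : 1 < x) := hasDerivAt_karamata hc.h_eq hc.eps_diff hx
  have hpos : ∀ᶠ u in atTop, 0 < h u := by
    filter_upwards [eventually_ge_atTop 1] with u hu
    have := hc.c_pos
    have hu0 : (0 : ℝ) < u := by linarith
    rw [hc.h_eq u hu]
    positivity
  have hdiff : ∀ᶠ u in atTop, DifferentiableAt ℝ h u :=
    (eventually_gt_atTop 1).mono fun u hu => (hder hu).differentiableAt
  have hel : ∀ᶠ u in atTop, |u * deriv h u / h u| ≤ β + 1 := by
    have := (hc.eps_to_zero.const_add β).abs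
    rw [add_zero, abs_of_pos hβ] at this
    filter_upwards [this.eventually_le_const (lt_add_one β), eventually_gt_atTop 1, hpos]
      with u h1 h2 h3
    rw [(hder h2).deriv]
    have : u ≠ 0 := by positivity
    have e : u * (h u * (β + ε u) / u) / h u = β + ε u := by field_simp
    rwa [e]
  set s : ℝ → ℝ := fun t => √(ψ t / (t * β))
  have hsx : Tendsto (fun t => s t / ψ t) atTop (nhds 0) := by
    have h1 : Tendsto (fun t => ψ t * (t * β)) atTop atTop :=
      hψ_top.atTop_mul_atTop₀ (tendsto_id.atTop_mul_const hβ)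
    have h2 := (Real.continuous_sqrt.tendsto 0).comp h1.inv_tendsto_atTop
    rw [Real.sqrt_zero] at h2
    refine h2.congr' ?_
    filter_upwards [hψ_top.eventually_gt_atTop 0, eventually_gt_atTop 0] with t a1 a2
    simp only [Function.comp, Pi.inv_apply]
    rw [eq_div_iff a1.ne']
    nth_rw 2 [← Real.sqrt_sq a1.le]
    rw [← Real.sqrt_mul (by positivity)]
    congr 1
    field_simp
  refine ⟨s, ?_, hsx, fun z => ?_⟩
  · filter_upwards [hψ_top.eventually_gt_atTop 0, eventually_gt_atTop 0] with t h1 h2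
    positivity
  have hb1 := tendsto_add_mul_div_self hψ_top hsx z
  have hb := tendsto_add_mul_atTop hψ_top hsx z
  have hξ : ∀ᶠ t in atTop, ∃ ξ, ξ ∈ uIcc (ψ t) (ψ t + s t * z) ∧
      h (ψ t + s t * z) - h (ψ t) = h ξ * (β + ε ξ) / ξ * (ψ t + s t * z - ψ t) := by
    filter_upwards [hψ_top.eventually_gt_atTop 1, hb.eventually_gt_atTop 1] with t h1 h2
    exact exists_mem_uIcc_sub_eq_mul fun u hu => hder ((lt_min h1 h2).trans_le hu.1)
  obtain ⟨ξ, hξ⟩ := hξ.choice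
  have hξ1 := tendsto_div_of_mem_uIcc hψ_top hb1 (hξ.mono fun t ht => ht.1)
  have hξ_top : Tendsto ξ atTop atTop := by
    refine (hξ1.pos_mul_atTop one_pos hψ_top).congr' ?_
    filter_upwards [hψ_top.eventually_ne_atTop 0] with t ht
    field_simp
  have hh := tendsto_div_comp_of_bounded_elasticity hpos hdiff hel hψ_top hξ1
  have hε : Tendsto (fun t => (β + ε (ξ t)) / β) atTop (nhds 1) := by
    have := ((hc.eps_to_zero.comp hξ_top).const_add β).div_const β
    rwa [add_zero, div_self hβ.ne'] at this
  have hlim := (((hξ1.inv₀ one_ne_zero).mul hh).mul hε).const_mul z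
  rw [inv_one, one_mul, one_mul, mul_one] at hlim
  refine hlim.congr' ?_
  filter_upwards [hξ, hψ_inv, hψ_top.eventually_gt_atTop 0, eventually_gt_atTop 0,
    hξ_top.eventually_gt_atTop 0] with t h1 h2 h3 h4 h5
  have h6 := h1.2
  rw [h2, add_sub_cancel_left] at h6
  have h7 : s t * s t = ψ t / (t * β) := Real.mul_self_sqrt (by positivity)
  rw [h6, h2]
  calc _ = ψ t / (t * β) * (h (ξ t) * (β + ε (ξ t)) / ξ t * z) := by field_simp
    _ = _ := by rw [← h7]; ring

lemma Case2.eventually_eps_pos {h ψ ε : ℝ → ℝ} {c : ℝ} (hc : Case2 ψ c ε)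
    (hmono : MonotoneOn h (Ioi 0)) (hdiff : ∀ x > 0, DifferentiableAt ℝ h x)
    (hψ_inv : ∀ᶠ t in atTop, h (ψ t) = t) (hψ_top : Tendsto ψ atTop atTop) :
    ∀ᶠ t in atTop, 0 < ε t := by
  obtain ⟨T, hT⟩ := eventually_atTop.1 hψ_inv
  filter_upwards [eventually_gt_atTop T, hψ_top.eventually_gt_atTop 0, eventually_gt_atTop 1]
    with t h1 h2 h3
  have hψ := hasDerivAt_karamata (β := 0) (by simpa using hc.psi_eq) hc.eps_diff h3
  have e1 := (hdiff _ h2).hasDerivAt.comp t hψ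
  have e2 : HasDerivAt (h ∘ ψ) 1 t := (hasDerivAt_id t).congr_of_eventuallyEq <| by
    filter_upwards [Ioi_mem_nhds h1] with u hu using hT u (le_of_lt hu)
  have e3 := e1.unique e2
  have e4 : 0 ≤ deriv h (ψ t) := by
    rw [← derivWithin_of_isOpen isOpen_Ioi (mem_Ioi.2 h2)]
    exact hmono.derivWithin_nonneg
  have e5 : 0 < ψ t * (0 + ε t) / t := by
    by_contra! hneg
    nlinarith [mul_nonneg e4 (sub_nonneg.2 hneg)]
  have e6 : 0 < t := by linarith
  rw [zero_add, div_pos_iff_of_pos_right e6, mul_pos_iff_of_pos_left h2] at e5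
  exact e5

lemma Case2.tendsto_slope {h ψ ε : ℝ → ℝ} {c : ℝ} (hc : Case2 ψ c ε)
    (hmono : MonotoneOn h (Ioi 0)) (hdiff : ∀ x > 0, DifferentiableAt ℝ h x)
    (hψ_inv : ∀ᶠ t in atTop, h (ψ t) = t) (hψ_top : Tendsto ψ atTop atTop) :
    ∃ s : ℝ → ℝ, (∀ᶠ t in atTop, 0 < s t) ∧ Tendsto (fun t => s t / ψ t) atTop (nhds 0) ∧
      ∀ z, Tendsto (fun t => s t * (h (ψ t + s t * z) - t)) atTop (nhds z) := by
  have hε0 := hc.eventually_eps_pos hmono hdiff hψ_inv hψ_top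
  have hψ0 := hψ_top.eventually_gt_atTop 0
  have hder {t : ℝ} (ht : 1 < t) : HasDerivAt ψ (ψ t * ε t / t) t := by
    simpa using hasDerivAt_karamata (β := 0) (by simpa using hc.psi_eq) hc.eps_diff ht
  have hψ_el : ∀ᶠ u in atTop, |u * deriv ψ u / ψ u| ≤ 1 := by
    have := hc.eps_to_zero.abs
    rw [abs_zero] at this
    filter_upwards [this.eventually_le_const one_pos, eventually_gt_atTop 1, hψ0] with u h1 h2 h3
    rw [(hder h2).deriv]
    have : u ≠ 0 := by positivity
    have e : u * (ψ u * ε u / u) / ψ u = ε u := by field_simp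
    rwa [e]
  have hε_el : ∀ᶠ u in atTop, |u * deriv ε u / ε u| ≤ 1 := by
    have := hc.eps_ratio1.abs
    rw [abs_zero] at this
    exact this.eventually_le_const one_pos
  have hψ_diff : ∀ᶠ u in atTop, DifferentiableAt ℝ ψ u :=
    (eventually_gt_atTop 1).mono fun u hu => (hder hu).differentiableAt
  have hε_diff : ∀ᶠ u in atTop, DifferentiableAt ℝ ε u :=
    (eventually_ge_atTop 1).mono hc.eps_diff
  have htε : ∃ k > 0, ∀ᶠ t in atTop, k ≤ t * ε t := by
    obtain ⟨T, hT⟩ := eventually_atTop.1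
      (hε0.and (hε_el.and (hε_diff.and (eventually_gt_atTop 0))))
    have hmonoε : MonotoneOn (fun t => t * ε t) (Ici T) := by
      have hd : ∀ u ∈ Ici T, HasDerivAt (fun t => t * ε t) (1 * ε u + u * deriv ε u) u :=
        fun u hu => (hasDerivAt_id u).mul (hT u hu).2.2.1.hasDerivAt
      refine monotoneOn_of_deriv_nonneg (convex_Ici T)
        (fun u hu => (hd u hu).continuousAt.continuousWithinAt)
        (fun u hu => (hd u (interior_subset hu)).differentiableAt.differentiableWithinAt)
        fun u hu => ?_
      rw [(hd u (interior_subset hu)).deriv]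
      obtain ⟨a1, a2, -, -⟩ := hT u (interior_subset hu)
      have a3 := (abs_le.1 a2).1
      rw [le_div_iff₀ a1] at a3
      linarith
    obtain ⟨a1, -, -, a2⟩ := hT T le_rfl
    exact ⟨T * ε T, by positivity, (eventually_ge_atTop T).mono fun t ht =>
      hmonoε self_mem_Ici ht ht⟩
  obtain ⟨k, hk, hkt⟩ := htε
  set s : ℝ → ℝ := fun t => √(ψ t * ε t / t) with hs_def
  have hs : ∀ᶠ t in atTop, 0 < s t := by
    filter_upwards [hψ0, hε0, eventually_gt_atTop 0] with t h1 h2 h3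
    positivity
  have hs2 : ∀ᶠ t in atTop, s t * s t = ψ t * ε t / t := by
    filter_upwards [hψ0, hε0, eventually_gt_atTop 0] with t h1 h2 h3
    exact Real.mul_self_sqrt (by positivity)
  have hsx : Tendsto (fun t => s t / ψ t) atTop (nhds 0) := by
    have h1 : Tendsto (fun t => ε t * (ψ t * t)⁻¹) atTop (nhds (0 * 0)) :=
      hc.eps_to_zero.mul (hψ_top.atTop_mul_atTop₀ tendsto_id).inv_tendsto_atTop
    have h2 := (Real.continuous_sqrt.tendsto _).comp h1
    rw [mul_zero, Real.sqrt_zero] at h2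
    refine h2.congr' ?_
    filter_upwards [hψ0, hε0, eventually_gt_atTop 0] with t a1 a2 a3
    simp only [Function.comp]
    rw [eq_div_iff a1.ne']
    nth_rw 2 [← Real.sqrt_sq a1.le]
    rw [← Real.sqrt_mul (by positivity)]
    congr 1
    field_simp
  have hst : Tendsto (fun t => (s t)⁻¹ / t) atTop (nhds 0) := by
    have h1 : Tendsto (fun t => t * ε t * ψ t) atTop atTop := by
      refine tendsto_atTop_mono' _ ?_ (hψ_top.const_mul_atTop hk)
      filter_upwards [hkt, hψ0] with t a1 a2
      exact mul_le_mul_of_nonneg_right a1 a2.le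
    have h2 := (Real.continuous_sqrt.tendsto _).comp h1.inv_tendsto_atTop
    rw [Real.sqrt_zero] at h2
    refine h2.congr' ?_
    filter_upwards [hψ0, hε0, eventually_gt_atTop 0] with t a1 a2 a3
    simp only [Function.comp, hs_def, Pi.inv_apply]
    rw [eq_div_iff a3.ne']
    nth_rw 4 [← Real.sqrt_sq a3.le]
    rw [← Real.sqrt_mul (by positivity), ← Real.sqrt_inv]
    congr 1
    field_simp
  have hψ_slope (z : ℝ) :
      Tendsto (fun t => (ψ (t + (s t)⁻¹ * z) - ψ t) / s t) atTop (nhds z) := by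
    have hb1 := tendsto_add_mul_div_self tendsto_id hst z
    have hb := tendsto_add_mul_atTop tendsto_id hst z
    simp only [id] at hb1 hb
    have hξ : ∀ᶠ t in atTop, ∃ ξ, ξ ∈ uIcc t (t + (s t)⁻¹ * z) ∧
        ψ (t + (s t)⁻¹ * z) - ψ t = ψ ξ * ε ξ / ξ * (t + (s t)⁻¹ * z - t) := by
      filter_upwards [eventually_gt_atTop 1, hb.eventually_gt_atTop 1] with t h1 h2
      exact exists_mem_uIcc_sub_eq_mul fun u hu => hder ((lt_min h1 h2).trans_le hu.1)
    obtain ⟨ξ, hξ⟩ := hξ.choice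
    have hξ1 := tendsto_div_of_mem_uIcc tendsto_id hb1 (hξ.mono fun t ht => ht.1)
    simp only [id] at hξ1
    have hξ_top : Tendsto ξ atTop atTop := by
      refine (hξ1.pos_mul_atTop one_pos tendsto_id).congr' ?_
      filter_upwards [eventually_ne_atTop 0] with t ht
      simp only [id]
      field_simp
    have hh := tendsto_div_comp_of_bounded_elasticity hψ0 hψ_diff hψ_el tendsto_id hξ1
    have hε := tendsto_div_comp_of_bounded_elasticity hε0 hε_diff hε_el tendsto_id hξ1
    have hlim := (((hξ1.inv₀ one_ne_zero).mul hh).mul hε).const_mul z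
    rw [inv_one, one_mul, one_mul, mul_one] at hlim
    refine hlim.congr' ?_
    filter_upwards [hξ, hψ0, hε0, hs, hs2, eventually_gt_atTop 0,
      hξ_top.eventually_gt_atTop 0] with t h1 h2 h3 h4 h5 h6 h7
    rw [h1.2, add_sub_cancel_left]
    have e : ψ (ξ t) * ε (ξ t) / ξ t * ((s t)⁻¹ * z) / s t
        = ψ (ξ t) * ε (ξ t) / ξ t * z / (s t * s t) := by field_simp
    rw [e, h5]
    simp only [id]
    field_simp
  refine ⟨s, hs, hsx, fun z => ?_⟩
  have harg (y : ℝ) := tendsto_add_mul_atTop tendsto_id hst y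
  simp only [id] at harg
  rw [tendsto_order]
  refine ⟨fun e he => ?_, fun e he => ?_⟩
  · obtain ⟨e', h1, h2⟩ := exists_between he
    filter_upwards [(hψ_slope e').eventually_lt_const h2, (harg e').eventually hψ_inv,
      (hψ_top.comp (harg e')).eventually_gt_atTop 0,
      (tendsto_add_mul_atTop hψ_top hsx z).eventually_gt_atTop 0, hs] with t a1 a2 a3 a4 a5
    rw [div_lt_iff₀ a5] at a1
    have := hmono (mem_Ioi.2 a3) (mem_Ioi.2 a4) (by simp only [Function.comp]; linarith)
    simp only [Function.comp, a2] at this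
    calc e < e' := h1
      _ = s t * ((s t)⁻¹ * e') := by field_simp
      _ ≤ _ := mul_le_mul_of_nonneg_left (by linarith) a5.le
  · obtain ⟨e', h1, h2⟩ := exists_between he
    filter_upwards [(hψ_slope e').eventually_const_lt h1, (harg e').eventually hψ_inv,
      (hψ_top.comp (harg e')).eventually_gt_atTop 0,
      (tendsto_add_mul_atTop hψ_top hsx z).eventually_gt_atTop 0, hs] with t a1 a2 a3 a4 a5
    rw [lt_div_iff₀ a5] at a1
    have := hmono (mem_Ioi.2 a4) (mem_Ioi.2 a3) (by simp only [Function.comp]; linarith)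
    simp only [Function.comp, a2] at this
    calc _ ≤ s t * ((s t)⁻¹ * e') := mul_le_mul_of_nonneg_left (by linarith) a5.le
      _ = e' := by field_simp
      _ < e := h2

/-- as `t → ∞`, the normalized tilted random variables
`(𝒳_t − m(t))/s(t)` converge in distribution to the standard normal law, i.e. for every
bounded continuous `f`, `E[f((𝒳_t − m(t))/s(t))] → ∫ f dN(0,1)`. -/
theorem tilted_clt
    (g ψ q p Φ : ℝ → ℝ)
    (hg_pos : ∀ x > (0:ℝ), 0 < g x)
    (hg_conv : ConvexOn ℝ (Set.Ioi 0) g)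
    (hg_smooth : ContDiffOn ℝ 4 g (Set.Ioi 0))
    (hg_super : Tendsto (fun x => g x / x) atTop atTop)
    (hh_mono : ∃ x₀ : ℝ, StrictMonoOn (deriv g) (Set.Ioi x₀))
    (hh_top : Tendsto (deriv g) atTop atTop)
    (hψ_inv : ∀ᶠ t in atTop, deriv g (ψ t) = t)
    (hψ_inv' : ∀ᶠ x in atTop, ψ (deriv g x) = x)
    (hψ_top : Tendsto ψ atTop atTop)
    (hq_meas : Measurable q)
    (hq_bdd : ∃ M : ℝ, ∀ x ≥ (0:ℝ), |q x| ≤ M)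
    (hcase :
      (∃ β c θ ε, Case1 (deriv g) β c θ ε ∧
        ∃ η, η < θ - 3 * β / 2 - 3 / 2 ∧ RegVary η (fun x => |q x|)) ∨
      (∃ c ε, Case2 ψ c ε ∧
        ∃ η, η < -(1/2 : ℝ) ∧ RegVary η (fun t => |q (ψ t)|)))
    (hp : ∀ x, p x = if 0 ≤ x then Real.exp (-(g x - q x)) else 0)
    (hΦ : ∀ t, Φ t = ∫ x, Real.exp (t * x) * p x)
    (hΦ_int : ∀ t > (0:ℝ), Integrable (fun x => Real.exp (t * x) * p x)) :
    ∀ f : BoundedContinuousFunction ℝ ℝ,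
      Tendsto (fun t =>
          ∫ x, f ((x - deriv (fun u => Real.log (Φ u)) t) /
              Real.sqrt (iteratedDeriv 2 (fun u => Real.log (Φ u)) t)) *
            (Real.exp (t * x) * p x / Φ t))
        atTop (nhds (∫ x, f x ∂(gaussianReal 0 1))) := by
  intro f
  have hg : ∀ u > 0, DifferentiableAt ℝ g u := fun u hu =>
    (hg_smooth.contDiffAt (Ioi_mem_nhds hu)).differentiableAt (by norm_num)
  have hh : ∀ u > 0, DifferentiableAt ℝ (deriv g) u := fun u hu =>
    ((hg_smooth.contDiffAt (Ioi_mem_nhds hu)).derivWithin (m := 1) (by norm_num)).differentiableAt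
      one_ne_zero
  have hmono : MonotoneOn (deriv g) (Set.Ioi 0) := hg_conv.monotoneOn_deriv hg
  obtain ⟨M, hM⟩ := hq_bdd
  have hcore : Tendsto q atTop (nhds 0) ∧ ∃ s : ℝ → ℝ, (∀ᶠ t in atTop, 0 < s t) ∧
      Tendsto (fun t => s t / ψ t) atTop (nhds 0) ∧
      ∀ z, Tendsto (fun t => s t * (deriv g (ψ t + s t * z) - t)) atTop (nhds z) := by
    rcases hcase with ⟨β, c, θ, ε, hc, η, hη, hq⟩ | ⟨c, ε, hc, η, hη, hq⟩
    · refine ⟨?_, hc.tendsto_slope hψ_inv hψ_top⟩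
      have hβ := hc.beta_pos
      have hθ := hc.theta_le
      exact (tendsto_zero_iff_abs_tendsto_zero q).2
        (hq.tendsto_zero (by linarith) ((eventually_ge_atTop 0).mono hM))
    · refine ⟨?_, hc.tendsto_slope hmono hh hψ_inv hψ_top⟩
      have h0 := hq.tendsto_zero (by linarith)
        ((hψ_top.eventually_ge_atTop 0).mono fun t ht => hM _ ht)
      refine (tendsto_zero_iff_abs_tendsto_zero q).2 ((h0.comp hh_top).congr' ?_)
      filter_upwards [hψ_inv'] with x hx
      simp only [Function.comp, hx]
  obtain ⟨hq_lim, s, hs, hsx, hD⟩ := hcore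
  exact tilted_clt_of_tendsto_slope hg_conv hg hq_meas ⟨M, hM⟩ hq_lim hp hΦ hΦ_int hs hψ_top hsx
    hψ_inv hD f
end
end

section
/- Suppose h belongs to ℛ (i.e. Case 1 or Case 2 holds). Then log σ̂(t) / ∫₁^t ψ(u) du → 0 as t → ∞, where σ̂²(t) = 1/h'(ψ(t)) = ψ'(t). -/
open Real Filter MeasureTheory Set ProbabilityTheory Asymptotics

noncomputable section

/-- A function whose derivative is `o(1 / t)` is `o(log t)`. -/
theorem isLittleO_log_of_hasDerivAt {u d : ℝ → ℝ}
    (hu : ∀ᶠ t in atTop, HasDerivAt u (d t / t) t) (hd : Tendsto d atTop (nhds 0)) :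
    u =o[atTop] Real.log := by
  rw [isLittleO_iff]
  intro k hk
  have hd' : ∀ᶠ t in atTop, ‖d t‖ < k / 2 := by
    have := hd.norm
    rw [norm_zero] at this
    exact this.eventually_lt_const (by positivity)
  obtain ⟨T, hT⟩ := eventually_atTop.1 (hu.and (hd'.and (eventually_ge_atTop 1)))
  have hT1 : 1 ≤ T := (hT T le_rfl).2.2
  have hbig : ∀ᶠ t in atTop, ‖u T‖ ≤ k / 2 * Real.log t :=
    (Real.tendsto_log_atTop.const_mul_atTop (by positivity : 0 < k / 2)).eventually_ge_atTop _
  filter_upwards [hbig, eventually_ge_atTop T] with t htb htT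
  have key : ‖u t‖ ≤ ‖u T‖ + k / 2 * (Real.log t - Real.log T) := by
    refine image_norm_le_of_norm_deriv_right_le_deriv_boundary' (a := T) (b := t)
      (f := u) (f' := fun x => d x / x)
      (B := fun x => ‖u T‖ + k / 2 * (Real.log x - Real.log T))
      (B' := fun x => k / 2 * x⁻¹) ?_ ?_ (by simp) ?_ ?_ ?_ ⟨htT, le_rfl⟩
    · exact fun x hx => (hT x hx.1).1.continuousAt.continuousWithinAt
    · exact fun x hx => (hT x hx.1).1.hasDerivWithinAt
    · intro x hx
      have hx0 : x ≠ 0 := by linarith [hx.1]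
      exact (((Real.continuousAt_log hx0).sub continuousAt_const).const_mul _
        |>.const_add _).continuousWithinAt
    · intro x hx
      have hx0 : x ≠ 0 := by linarith [hx.1]
      exact ((((Real.hasDerivAt_log hx0).sub_const _).const_mul _).const_add _).hasDerivWithinAt
    · intro x hx
      have hx0 : 0 < x := by linarith [hx.1]
      rw [norm_div, Real.norm_of_nonneg hx0.le, div_eq_mul_inv]
      exact mul_le_mul_of_nonneg_right (hT x hx.1).2.1.le (by positivity)
  have hlogT : 0 ≤ Real.log T := Real.log_nonneg hT1
  have hlogt : 0 ≤ Real.log t := Real.log_nonneg (hT1.trans htT)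
  rw [Real.norm_of_nonneg hlogt]
  nlinarith

theorem hasDerivAt_integral_div {ε : ℝ → ℝ}
    (hε : ∀ x ≥ (1:ℝ), DifferentiableAt ℝ ε x) {x : ℝ} (hx : 1 < x) :
    HasDerivAt (fun y => ∫ u in (1:ℝ)..y, ε u / u) (ε x / x) x := by
  have hc : ∀ y ≥ (1:ℝ), ContinuousAt (fun u => ε u / u) y := fun y hy =>
    (hε y hy).continuousAt.div continuousAt_id (by simp; linarith)
  refine intervalIntegral.integral_hasDerivAt_right ?_ ?_ (hc x hx.le)
  · refine ContinuousOn.intervalIntegrable fun y hy => (hc y ?_).continuousWithinAt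
    rw [uIcc_of_le hx.le] at hy
    exact hy.1
  · exact ContinuousOn.stronglyMeasurableAtFilter isOpen_Ioi
      (fun y hy => (hc y (le_of_lt hy)).continuousWithinAt) x hx

/-- If `ψ → ∞`, then `∫₁ᵗ ψ` eventually exceeds `t`, unless `ψ` is not integrable on `[1, t]`. -/
theorem eventually_le_integral_or_eq_zero {ψ : ℝ → ℝ} (hψ : Tendsto ψ atTop atTop) :
    ∀ᶠ t in atTop, t ≤ ∫ u in (1:ℝ)..t, ψ u ∨ ∫ u in (1:ℝ)..t, ψ u = 0 := by
  obtain ⟨T, hT⟩ := eventually_atTop.1 ((hψ.eventually_ge_atTop 2).and (eventually_ge_atTop 1))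
  have hT1 : 1 ≤ T := (hT T le_rfl).2
  filter_upwards [eventually_ge_atTop T,
    eventually_ge_atTop (2 * T - ∫ u in (1:ℝ)..T, ψ u)] with t htT ht
  by_cases hi : IntervalIntegrable ψ volume 1 t
  · left
    have h1 : IntervalIntegrable ψ volume 1 T := hi.mono_set (by
      rw [uIcc_of_le hT1, uIcc_of_le (hT1.trans htT)]; exact Icc_subset_Icc_right htT)
    have h2 : IntervalIntegrable ψ volume T t := hi.mono_set (by
      rw [uIcc_of_le htT, uIcc_of_le (hT1.trans htT)]; exact Icc_subset_Icc_left hT1)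
    have h3 : ∫ _ in T..t, (2:ℝ) ≤ ∫ u in T..t, ψ u :=
      intervalIntegral.integral_mono_on htT intervalIntegrable_const h2 fun x hx => (hT x hx.1).1
    rw [intervalIntegral.integral_const, smul_eq_mul] at h3
    rw [← intervalIntegral.integral_add_adjacent_intervals h1 h2]
    linarith
  · exact Or.inr (intervalIntegral.integral_undef hi)

theorem abs_log_sqrt_le (x : ℝ) : |Real.log (Real.sqrt x)| ≤ |Real.log x| := by
  rcases le_total 0 x with hx | hx
  · rw [Real.log_sqrt hx, abs_div, abs_two]
    linarith [abs_nonneg (Real.log x)]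
  · simp [Real.sqrt_eq_zero_of_nonpos hx]

theorem tendsto_log_sqrt_div_integral {ψ v : ℝ → ℝ} (hψ : Tendsto ψ atTop atTop)
    (hv : (fun t => Real.log (v t)) =O[atTop] Real.log) :
    Tendsto (fun t => Real.log (Real.sqrt (1 / v t)) / ∫ u in (1:ℝ)..t, ψ u) atTop (nhds 0) := by
  have hlim : Tendsto (fun t => |Real.log (v t) / t|) atTop (nhds 0) := by
    simpa using (hv.trans_isLittleO Real.isLittleO_log_id_atTop).tendsto_div_nhds_zero.abs
  refine squeeze_zero_norm' ?_ hlim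
  filter_upwards [eventually_le_integral_or_eq_zero hψ, eventually_gt_atTop 0] with t ht ht0
  rcases ht with ht | ht
  · have hlog := abs_log_sqrt_le (1 / v t)
    rw [one_div, Real.log_inv, abs_neg] at hlog
    rw [one_div, Real.norm_eq_abs, abs_div, abs_div, abs_of_pos ht0, abs_of_pos (ht0.trans_le ht)]
    gcongr
  · rw [ht, div_zero, norm_zero]
    positivity

theorem Case1.hasDerivAt {h ε : ℝ → ℝ} {β c θ : ℝ} (H : Case1 h β c θ ε) {x : ℝ} (hx : 1 < x) :
    HasDerivAt h (h x * (β + ε x) / x) x := by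
  have hx0 : x ≠ 0 := by linarith
  have hder := ((Real.hasDerivAt_rpow_const (p := β) (Or.inl hx0)).const_mul c).mul
    (hasDerivAt_integral_div H.eps_diff hx).exp
  have heq : h =ᶠ[nhds x] fun y => c * y ^ β * Real.exp (∫ u in (1:ℝ)..y, ε u / u) := by
    filter_upwards [Ioi_mem_nhds hx] with y hy using H.h_eq y (le_of_lt hy)
  refine HasDerivAt.congr_of_eventuallyEq ?_ heq
  refine hder.congr_deriv ?_
  rw [H.h_eq x hx.le, Real.rpow_sub_one hx0]
  field_simp

theorem Case1.log_sub_isLittleO {h ε : ℝ → ℝ} {β c θ : ℝ} (H : Case1 h β c θ ε) :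
    (fun x => Real.log (h x) - β * Real.log x) =o[atTop] Real.log := by
  have hI : (fun x => ∫ u in (1:ℝ)..x, ε u / u) =o[atTop] Real.log :=
    isLittleO_log_of_hasDerivAt
      ((eventually_gt_atTop 1).mono fun x hx => hasDerivAt_integral_div H.eps_diff hx)
      H.eps_to_zero
  refine (Real.isLittleO_const_log_atTop (c := Real.log c) |>.add hI).congr' ?_ .rfl
  filter_upwards [eventually_ge_atTop 1] with x hx
  have hx0 : 0 < x := by linarith
  rw [H.h_eq x hx, Real.log_mul (mul_pos H.c_pos (Real.rpow_pos_of_pos hx0 _)).ne'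
    (Real.exp_pos _).ne', Real.log_mul H.c_pos.ne' (Real.rpow_pos_of_pos hx0 _).ne',
    Real.log_rpow hx0, Real.log_exp]
  ring

theorem Case1.log_deriv_isBigO {h ψ ε : ℝ → ℝ} {β c θ : ℝ} (H : Case1 h β c θ ε)
    (hψ_inv : ∀ᶠ t in atTop, h (ψ t) = t) (hψ : Tendsto ψ atTop atTop) :
    (fun t => Real.log (deriv h (ψ t))) =O[atTop] Real.log := by
  have hβ := H.beta_pos
  have hlogψ : (fun t => Real.log (ψ t)) =O[atTop] Real.log := by
    have hlog : (fun x => β * Real.log x) =O[atTop] fun x => Real.log (h x) := by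
      have := (H.log_sub_isLittleO.trans_isBigO
        (isBigO_self_const_mul hβ.ne' Real.log atTop)).right_isBigO_add
      simpa using this
    have hc := ((isBigO_self_const_mul hβ.ne' Real.log atTop).trans hlog).comp_tendsto hψ
    refine hc.congr' .rfl ?_
    filter_upwards [hψ_inv] with t ht
    simp [ht]
  have hconst : (fun t => Real.log (β + ε (ψ t))) =O[atTop] Real.log := by
    have hlim : Tendsto (fun t => Real.log (β + ε (ψ t))) atTop (nhds (Real.log (β + 0))) :=
      ((H.eps_to_zero.comp hψ).const_add β).log (by simpa using hβ.ne')
    exact (hlim.isBigO_one ℝ).trans (Real.isLittleO_const_log_atTop (c := 1)).isBigO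
  have hpos : ∀ᶠ t in atTop, 0 < β + ε (ψ t) :=
    ((H.eps_to_zero.comp hψ).const_add β).eventually_const_lt (by simpa using hβ)
  refine (((isBigO_refl Real.log atTop).add hconst).sub hlogψ).congr' ?_ .rfl
  filter_upwards [hψ_inv, hpos, hψ.eventually_gt_atTop 1, eventually_gt_atTop 0]
    with t ht htp htψ ht0
  rw [(H.hasDerivAt htψ).deriv, ht, Real.log_div (mul_pos ht0 htp).ne' (by linarith),
    Real.log_mul ht0.ne' htp.ne']

theorem Case2.hasDerivAt {ψ ε : ℝ → ℝ} {c : ℝ} (H : Case2 ψ c ε) {t : ℝ} (ht : 1 < t) :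
    HasDerivAt ψ (ψ t * (ε t / t)) t := by
  have heq : ψ =ᶠ[nhds t] fun y => c * Real.exp (∫ u in (1:ℝ)..y, ε u / u) := by
    filter_upwards [Ioi_mem_nhds ht] with y hy using H.psi_eq y (le_of_lt hy)
  refine HasDerivAt.congr_of_eventuallyEq ?_ heq
  rw [H.psi_eq t ht.le, mul_assoc]
  exact (hasDerivAt_integral_div H.eps_diff ht).exp.const_mul c

theorem Case2.log_deriv_isBigO {h ψ ε : ℝ → ℝ} {c : ℝ} (H : Case2 ψ c ε)
    (hdiff : ∀ x > (0:ℝ), DifferentiableAt ℝ h x)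
    (hψ_inv : ∀ᶠ t in atTop, h (ψ t) = t) :
    (fun t => Real.log (deriv h (ψ t))) =O[atTop] Real.log := by
  have hψ_pos : ∀ t ≥ (1:ℝ), 0 < ψ t := fun t ht => by
    rw [H.psi_eq t ht]
    exact mul_pos H.c_pos (Real.exp_pos _)
  have hinv : ∀ᶠ t in atTop, deriv h (ψ t) * (ψ t * (ε t / t)) = 1 := by
    obtain ⟨T, hT⟩ := eventually_atTop.1 hψ_inv
    filter_upwards [eventually_gt_atTop T, eventually_gt_atTop 1] with t htT ht1
    have hcomp := (hdiff _ (hψ_pos t ht1.le)).hasDerivAt.comp t (H.hasDerivAt ht1)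
    have heq : h ∘ ψ =ᶠ[nhds t] id := by
      filter_upwards [Ioi_mem_nhds htT] with y hy using hT y (le_of_lt hy)
    exact (hcomp.congr_of_eventuallyEq heq.symm).unique (hasDerivAt_id t)
  have hε_ne : ∀ᶠ t in atTop, ε t ≠ 0 := by
    filter_upwards [hinv] with t ht h0
    simp [h0] at ht
  have hlogψ : (fun t => Real.log (ψ t)) =o[atTop] Real.log := by
    refine isLittleO_log_of_hasDerivAt ?_ H.eps_to_zero
    filter_upwards [eventually_gt_atTop 1] with t ht
    have hne := (hψ_pos t ht.le).ne'
    convert (H.hasDerivAt ht).log hne using 1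
    field_simp
  have hlogε : (fun t => Real.log (ε t)) =o[atTop] Real.log := by
    refine isLittleO_log_of_hasDerivAt ?_ H.eps_ratio1
    filter_upwards [eventually_gt_atTop 1, hε_ne] with t ht hne
    have ht0 : t ≠ 0 := by linarith
    convert (H.eps_diff t ht.le).hasDerivAt.log hne using 1
    field_simp
  refine (((isBigO_refl Real.log atTop).sub hlogψ.isBigO).sub hlogε.isBigO).congr' ?_ .rfl
  filter_upwards [hinv, hε_ne, eventually_gt_atTop 1] with t ht hne ht1
  have ht0 : t ≠ 0 := by linarith
  rw [eq_inv_of_mul_eq_one_left ht, Real.log_inv,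
    Real.log_mul (hψ_pos t ht1.le).ne' (div_ne_zero hne ht0), Real.log_div hne ht0]
  ring

/-- if `h ∈ ℛ` then `log σ̂(t) / ∫₁^t ψ(u) du → 0` as `t → ∞`,
where `σ̂²(t) = 1/h'(ψ(t))`. -/
theorem log_sigma_negligible
    (g ψ : ℝ → ℝ)
    (hg_pos : ∀ x > (0:ℝ), 0 < g x)
    (hg_conv : ConvexOn ℝ (Set.Ioi 0) g)
    (hg_smooth : ContDiffOn ℝ 4 g (Set.Ioi 0))
    (hg_super : Tendsto (fun x => g x / x) atTop atTop)
    (hh_mono : ∃ x₀ : ℝ, StrictMonoOn (deriv g) (Set.Ioi x₀))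
    (hh_top : Tendsto (deriv g) atTop atTop)
    (hψ_inv : ∀ᶠ t in atTop, deriv g (ψ t) = t)
    (hψ_inv' : ∀ᶠ x in atTop, ψ (deriv g x) = x)
    (hψ_top : Tendsto ψ atTop atTop)
    (hcase :
      (∃ β c θ ε, Case1 (deriv g) β c θ ε) ∨ (∃ c ε, Case2 ψ c ε))
    : Tendsto (fun t =>
        Real.log (Real.sqrt (1 / deriv (deriv g) (ψ t))) / ∫ u in (1:ℝ)..t, ψ u)
      atTop (nhds 0) := by
  refine tendsto_log_sqrt_div_integral hψ_top ?_
  rcases hcase with ⟨β, c, θ, ε, H⟩ | ⟨c, ε, H⟩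
  · exact H.log_deriv_isBigO hψ_inv hψ_top
  · have hsmooth : ContDiffOn ℝ 3 (deriv g) (Set.Ioi 0) :=
      hg_smooth.deriv_of_isOpen isOpen_Ioi (by norm_num)
    exact H.log_deriv_isBigO (fun x hx =>
      (hsmooth.differentiableOn (by norm_num)).differentiableAt (Ioi_mem_nhds hx)) hψ_inv
end
end
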